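/- arXiv:math-ph/0507026 — 4 statements merged into one kernel-verified Lean document; each statement's English description precedes it below -/
import Mathlib

section
/- Let c_v, R > 0 be constants and let u(s,v) = c_v · e^{s/c_v} · v^{−R/c_v} on ℝ × (0,∞) be the molar internal energy of an ideal gas, with Hessian η = (∂²u/∂xⁱ∂xʲ), (x¹,x²) = (s,v). Then the scalar-curvature expression 𝓡(η) vanishes identically: 𝓡(η)(s,v) = 0 for all (s,v) ∈ ℝ × (0,∞). -/
/-- The scalar-curvature expression of a two-dimensional (Hessian) thermodynamic metric
with entries `e11, e12, e22` (functions of the two coordinates), namely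
`𝓡 = −(1/(4·(det η)²)) · det !![η₁₁, ∂₁η₁₁, ∂₂η₁₁; η₁₂, ∂₁η₁₂, ∂₂η₁₂; η₂₂, ∂₁η₂₂, ∂₂η₂₂]`. -/
noncomputable def scalarCurv2 (e11 e12 e22 : ℝ → ℝ → ℝ) (x y : ℝ) : ℝ :=
  -(1 / (4 * (e11 x y * e22 x y - e12 x y ^ 2) ^ 2)) *
    Matrix.det
      !![e11 x y, deriv (fun a => e11 a y) x, deriv (fun b => e11 x b) y;
         e12 x y, deriv (fun a => e12 a y) x, deriv (fun b => e12 x b) y;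
         e22 x y, deriv (fun a => e22 a y) x, deriv (fun b => e22 x b) y]

theorem deriv_exp_div_mul (c k x : ℝ) :
    deriv (fun a => Real.exp (a / c) * k) x = Real.exp (x / c) * (k / c) := by
  have h : HasDerivAt (fun a : ℝ => Real.exp (a / c) * k) (Real.exp (x / c) * (1 / c) * k) x :=
    (((hasDerivAt_id x).div_const c).exp).mul_const k
  rw [h.deriv]
  ring

/-- If the metric depends on the first coordinate only through a common exponential factor,
then the first two columns of the determinant are proportional. -/
theorem scalarCurv2_exp_mul_eq_zero (c : ℝ) (f g h : ℝ → ℝ) (x y : ℝ) :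
    scalarCurv2 (fun x y => Real.exp (x / c) * f y) (fun x y => Real.exp (x / c) * g y)
      (fun x y => Real.exp (x / c) * h y) x y = 0 := by
  simp only [scalarCurv2, deriv_exp_div_mul, Matrix.det_fin_three, Matrix.of_apply,
    Matrix.cons_val', Matrix.cons_val]
  ring

/-- **Ideal gas has flat Weinhold metric.** For the molar internal energy
`u(s,v) = c_v · e^{s/c_v} · v^{−R/c_v}` of an ideal gas the scalar-curvature expression
of the Hessian (Weinhold) metric vanishes identically on `ℝ × (0,∞)`. -/
theorem ideal_gas_weinhold_flat (cv R : ℝ) (hcv : 0 < cv) (hR : 0 < R)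
    (u : ℝ → ℝ → ℝ)
    (hu : ∀ s v : ℝ, u s v = cv * Real.exp (s / cv) * v ^ (-(R / cv)))
    (s v : ℝ) (hv : 0 < v) :
    scalarCurv2
      (fun s v => deriv (fun a => deriv (fun b => u b v) a) s)
      (fun s v => deriv (fun a => deriv (fun b => u a b) v) s)
      (fun s v => deriv (fun b => deriv (fun c => u s c) b) v)
      s v = 0 := by
  obtain ⟨f, hf⟩ : ∃ f : ℝ → ℝ, u = fun s v => Real.exp (s / cv) * f v :=
    ⟨fun v => cv * v ^ (-(R / cv)), by funext s v; rw [hu]; ring⟩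
  simp only [hf, deriv_exp_div_mul, deriv_const_mul_field]
  exact scalarCurv2_exp_mul_eq_zero cv (fun v => f v / cv / cv) (fun v => deriv f v / cv)
    (fun v => deriv (deriv f) v) s v
end

section
/- Let T > 0, V ≥ 0, k_T > 0, C_v ≥ 0, α, ΔS, ΔV, A' be real numbers, set C_p = C_v + T V α²/k_T, and let M be the symmetric 3×3 matrix with rows (−C_p/T, αV, −ΔS), (αV, −k_T V, ΔV), (−ΔS, ΔV, −A'). Then det M = −(C_v k_T V/T)·A' + (C_v/T)·(ΔV)² + V k_T·(ΔS − (α/k_T)·ΔV)². In particular, if A' ≤ 0 then det M ≥ 0. -/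
/-- **Determinant of the Gibbs metric of a single chemical reaction.** With
`C_p = C_v + TVα²/k_T`, the symmetric matrix
`M = !![−C_p/T, αV, −ΔS; αV, −k_T V, ΔV; −ΔS, ΔV, −A']` has determinant
`det M = −(C_v k_T V/T)·A' + (C_v/T)·ΔV² + V k_T·(ΔS − (α/k_T)ΔV)²`; in particular,
if `A' ≤ 0` then `det M ≥ 0`. -/
theorem gibbs_metric_det_single_reaction
    (T V kT Cv α ΔS ΔV A' : ℝ)
    (hT : 0 < T) (hV : 0 ≤ V) (hkT : 0 < kT) (hCv : 0 ≤ Cv) :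
    let Cp : ℝ := Cv + T * V * α ^ 2 / kT
    let M : Matrix (Fin 3) (Fin 3) ℝ :=
      !![-Cp / T, α * V, -ΔS;
         α * V, -kT * V, ΔV;
         -ΔS, ΔV, -A']
    M.det = -(Cv * kT * V / T) * A' + (Cv / T) * ΔV ^ 2
        + V * kT * (ΔS - (α / kT) * ΔV) ^ 2 ∧
    (A' ≤ 0 → 0 ≤ M.det) := by
  intro Cp M
  have hdet : M.det = -(Cv * kT * V / T) * A' + (Cv / T) * ΔV ^ 2
      + V * kT * (ΔS - (α / kT) * ΔV) ^ 2 := by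
    simp only [M, Cp, Matrix.det_fin_three, Matrix.of_apply, Matrix.cons_val]
    field_simp
    ring
  refine ⟨hdet, fun hA => ?_⟩
  rw [hdet, neg_mul, ← mul_neg]
  have hA' : 0 ≤ -A' := neg_nonneg.mpr hA
  positivity
end

section
/- For the synthesis reaction 2H₂ + O₂ → 2H₂O with mole numbers N_{H₂}(ξ) = 2−2ξ, N_{O₂}(ξ) = 1−ξ, N_{H₂O}(ξ) = 2ξ and stoichiometric coefficients ν_{H₂} = −2, ν_{O₂} = −1, ν_{H₂O} = 2, the curve of phase boundary W(ξ) = (Σᵢνᵢ)²/ΣᵢNᵢ(ξ) − Σᵢ νᵢ²/Nᵢ(ξ) equals W(ξ) = −6/(ξ(1−ξ)(3−ξ)) for all ξ ∈ (0,1); in particular W(ξ) < 0 on (0,1). Moreover W has exactly one critical point in (0,1), namely ξ = (4−√7)/3 ≈ 0.4514, which is a strict maximum of W on (0,1). -/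
/-- `(4 - √7) / 3` is a root of `3 x² - 8 x + 3` lying in `(0, 1)`. -/
theorem criticalExtent_spec :
    (4 - Real.sqrt 7) / 3 ∈ Set.Ioo (0 : ℝ) 1 ∧
      3 * ((4 - Real.sqrt 7) / 3) ^ 2 - 8 * ((4 - Real.sqrt 7) / 3) + 3 = 0 := by
  have hsq : Real.sqrt 7 ^ 2 = 7 := Real.sq_sqrt (by norm_num)
  have hnonneg : 0 ≤ Real.sqrt 7 := Real.sqrt_nonneg 7
  refine ⟨⟨?_, ?_⟩, ?_⟩ <;> nlinarith

theorem extent_cubic_pos {ξ : ℝ} (hξ : ξ ∈ Set.Ioo (0 : ℝ) 1) :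
    0 < ξ * (1 - ξ) * (3 - ξ) :=
  mul_pos (mul_pos hξ.1 (sub_pos.2 hξ.2)) (by linarith [hξ.2])

theorem phaseBoundary_eq {ξ : ℝ} (hξ : ξ ∈ Set.Ioo (0 : ℝ) 1) :
    ((-2 : ℝ) + (-1) + 2) ^ 2 / ((2 - 2 * ξ) + (1 - ξ) + 2 * ξ)
        - ((-2 : ℝ) ^ 2 / (2 - 2 * ξ) + (-1 : ℝ) ^ 2 / (1 - ξ) + (2 : ℝ) ^ 2 / (2 * ξ))
      = -6 / (ξ * (1 - ξ) * (3 - ξ)) := by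
  have h0 : ξ ≠ 0 := hξ.1.ne'
  have h1 : 1 - ξ ≠ 0 := (sub_pos.2 hξ.2).ne'
  have h3 : 3 - ξ ≠ 0 := by linarith [hξ.2]
  rw [show (2 - 2 * ξ) + (1 - ξ) + 2 * ξ = 3 - ξ by ring,
    show 2 - 2 * ξ = 2 * (1 - ξ) by ring]
  field_simp
  ring

theorem hasDerivAt_neg_six_div_extent_cubic {ξ : ℝ} (hξ : ξ ∈ Set.Ioo (0 : ℝ) 1) :
    HasDerivAt (fun x : ℝ => -6 / (x * (1 - x) * (3 - x)))
      (6 * (3 * ξ ^ 2 - 8 * ξ + 3) / (ξ * (1 - ξ) * (3 - ξ)) ^ 2) ξ := by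
  have hcubic := ((hasDerivAt_id' ξ).mul ((hasDerivAt_id' ξ).const_sub 1)).mul
    ((hasDerivAt_id' ξ).const_sub 3)
  refine ((hasDerivAt_const ξ (-6 : ℝ)).div hcubic (extent_cubic_pos hξ).ne').congr_deriv ?_
  simp only [Pi.mul_apply]
  ring

/-- A critical point of `x (1 - x) (3 - x)` in `(0, 1)` is its strict maximum there. -/
theorem extent_cubic_lt_of_critical {c ξ : ℝ} (hc : c ∈ Set.Ioo (0 : ℝ) 1)
    (hcrit : 3 * c ^ 2 - 8 * c + 3 = 0) (hξ : ξ ∈ Set.Ioo (0 : ℝ) 1) (hne : ξ ≠ c) :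
    ξ * (1 - ξ) * (3 - ξ) < c * (1 - c) * (3 - c) := by
  have hprod : 0 < (ξ - c) ^ 2 * (4 - 2 * c - ξ) :=
    mul_pos (sq_pos_of_ne_zero (sub_ne_zero.2 hne)) (by linarith [hc.2, hξ.2])
  have hfactor : c * (1 - c) * (3 - c) - ξ * (1 - ξ) * (3 - ξ)
      = (ξ - c) ^ 2 * (4 - 2 * c - ξ) := by
    linear_combination (c - ξ) * hcrit
  linarith

/-- **Curve of phase boundary for the synthesis reaction `2H₂ + O₂ → 2H₂O`.** With mole
numbers `N_{H₂} = 2−2ξ`, `N_{O₂} = 1−ξ`, `N_{H₂O} = 2ξ` and stoichiometric coefficients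
`ν_{H₂} = −2`, `ν_{O₂} = −1`, `ν_{H₂O} = 2`, the curve of phase boundary
`W(ξ) = (Σᵢνᵢ)²/ΣᵢNᵢ(ξ) − Σᵢνᵢ²/Nᵢ(ξ)` equals `−6/(ξ(1−ξ)(3−ξ))` on `(0,1)`, is
negative there, and has the unique critical point `ξ = (4−√7)/3 ≈ 0.4514` in `(0,1)`,
which is a strict maximum of `W` on `(0,1)`. -/
theorem synthesis_reaction_phase_boundary (W : ℝ → ℝ)
    (hW : ∀ ξ : ℝ, W ξ
      = ((-2 : ℝ) + (-1) + 2) ^ 2 / ((2 - 2 * ξ) + (1 - ξ) + 2 * ξ)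
        - ((-2 : ℝ) ^ 2 / (2 - 2 * ξ) + (-1 : ℝ) ^ 2 / (1 - ξ) + (2 : ℝ) ^ 2 / (2 * ξ))) :
    (∀ ξ ∈ Set.Ioo (0 : ℝ) 1,
      W ξ = -6 / (ξ * (1 - ξ) * (3 - ξ)) ∧ W ξ < 0) ∧
    (∀ ξ ∈ Set.Ioo (0 : ℝ) 1, (deriv W ξ = 0 ↔ ξ = (4 - Real.sqrt 7) / 3)) ∧
    (∀ ξ ∈ Set.Ioo (0 : ℝ) 1, ξ ≠ (4 - Real.sqrt 7) / 3 →
      W ξ < W ((4 - Real.sqrt 7) / 3)) := by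
  obtain ⟨hc, hcrit⟩ := criticalExtent_spec
  have hWeq : Set.EqOn W (fun x => -6 / (x * (1 - x) * (3 - x))) (Set.Ioo 0 1) :=
    fun ξ hξ => (hW ξ).trans (phaseBoundary_eq hξ)
  refine ⟨fun ξ hξ => ⟨hWeq hξ, ?_⟩, fun ξ hξ => ?_, fun ξ hξ hne => ?_⟩
  · rw [hWeq hξ]
    exact div_neg_of_neg_of_pos (by norm_num) (extent_cubic_pos hξ)
  · have hderiv := (hasDerivAt_neg_six_div_extent_cubic hξ).congr_of_eventuallyEq
      (hWeq.eventuallyEq_of_mem (isOpen_Ioo.mem_nhds hξ))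
    rw [hderiv.deriv]
    constructor
    · intro h
      have hquad : 3 * ξ ^ 2 - 8 * ξ + 3 = 0 := by
        simpa using
          (div_eq_zero_iff.1 h).resolve_right (pow_ne_zero 2 (extent_cubic_pos hξ).ne')
      by_contra hne
      exact lt_asymm (extent_cubic_lt_of_critical hc hcrit hξ hne)
        (extent_cubic_lt_of_critical hξ hquad hc (Ne.symm hne))
    · rintro rfl
      rw [hcrit, mul_zero, zero_div]
  · rw [hWeq hξ, hWeq hc]
    have hinv := div_lt_div_of_pos_left (by norm_num : (0 : ℝ) < 6) (extent_cubic_pos hξ)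
      (extent_cubic_lt_of_critical hc hcrit hξ hne)
    simpa only [neg_div, neg_lt_neg_iff] using hinv
end

section
/- For the dissociation reaction 2H₂O → 2H₂ + O₂ with mole numbers N_{H₂O}(ξ) = 2−2ξ, N_{H₂}(ξ) = 2ξ, N_{O₂}(ξ) = ξ and stoichiometric coefficients ν_{H₂O} = −2, ν_{H₂} = 2, ν_{O₂} = 1, the curve of phase boundary W(ξ) = (Σᵢνᵢ)²/ΣᵢNᵢ(ξ) − Σᵢ νᵢ²/Nᵢ(ξ) equals W(ξ) = −6/(ξ(1−ξ)(2+ξ)) for all ξ ∈ (0,1). Moreover W has exactly one critical point in (0,1), namely ξ = (√7−1)/3 ≈ 0.5486, a strict maximum, and the critical extents of the dissociation and of the reverse synthesis reaction sum to one: (√7−1)/3 + (4−√7)/3 = 1. -/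
theorem dissociation_cubic_pos {x : ℝ} (hx : x ∈ Set.Ioo (0 : ℝ) 1) :
    0 < x * (1 - x) * (2 + x) :=
  mul_pos (mul_pos hx.1 (sub_pos.2 hx.2)) (by linarith [hx.1])

theorem hasDerivAt_dissociation_curve {x : ℝ} (hx : x ∈ Set.Ioo (0 : ℝ) 1) :
    HasDerivAt (fun y : ℝ => -6 / (y * (1 - y) * (2 + y)))
      (6 * (2 - 2 * x - 3 * x ^ 2) / (x * (1 - x) * (2 + x)) ^ 2) x := by
  have hcubic : HasDerivAt (fun y : ℝ => y * (1 - y) * (2 + y)) (2 - 2 * x - 3 * x ^ 2) x := by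
    refine (((hasDerivAt_id' x).mul ((hasDerivAt_id' x).const_sub 1)).mul
      ((hasDerivAt_id' x).const_add 2)).congr_deriv ?_
    simp only [Pi.mul_apply]
    ring
  refine ((hasDerivAt_const x (-6 : ℝ)).div hcubic (dissociation_cubic_pos hx).ne').congr_deriv ?_
  ring

theorem sqrt_seven_critical_mem_Ioo : (Real.sqrt 7 - 1) / 3 ∈ Set.Ioo (0 : ℝ) 1 := by
  have h7 : Real.sqrt 7 ^ 2 = 7 := Real.sq_sqrt (by norm_num)
  have h0 : 0 ≤ Real.sqrt 7 := Real.sqrt_nonneg 7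
  constructor <;> nlinarith

theorem sqrt_seven_critical_eq :
    2 - 2 * ((Real.sqrt 7 - 1) / 3) - 3 * ((Real.sqrt 7 - 1) / 3) ^ 2 = 0 := by
  have h7 : Real.sqrt 7 ^ 2 = 7 := Real.sq_sqrt (by norm_num)
  linear_combination (-1 / 3) * h7


/-- **Curve of phase boundary for the dissociation reaction `2H₂O → 2H₂ + O₂`.** With
mole numbers `N_{H₂O} = 2−2ξ`, `N_{H₂} = 2ξ`, `N_{O₂} = ξ` and stoichiometric
coefficients `ν_{H₂O} = −2`, `ν_{H₂} = 2`, `ν_{O₂} = 1`, the curve of phase boundary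
`W(ξ) = (Σᵢνᵢ)²/ΣᵢNᵢ(ξ) − Σᵢνᵢ²/Nᵢ(ξ)` equals `−6/(ξ(1−ξ)(2+ξ))` on `(0,1)` and has
the unique critical point `ξ = (√7−1)/3 ≈ 0.5486` in `(0,1)`, a strict maximum;
moreover the critical extents of the dissociation and of the reverse synthesis
reaction sum to one: `(√7−1)/3 + (4−√7)/3 = 1`. -/
theorem dissociation_reaction_phase_boundary (W : ℝ → ℝ)
    (hW : ∀ ξ : ℝ, W ξ
      = ((-2 : ℝ) + 2 + 1) ^ 2 / ((2 - 2 * ξ) + 2 * ξ + ξ)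
        - ((-2 : ℝ) ^ 2 / (2 - 2 * ξ) + (2 : ℝ) ^ 2 / (2 * ξ) + (1 : ℝ) ^ 2 / ξ)) :
    (∀ ξ ∈ Set.Ioo (0 : ℝ) 1, W ξ = -6 / (ξ * (1 - ξ) * (2 + ξ))) ∧
    (∀ ξ ∈ Set.Ioo (0 : ℝ) 1, (deriv W ξ = 0 ↔ ξ = (Real.sqrt 7 - 1) / 3)) ∧
    (∀ ξ ∈ Set.Ioo (0 : ℝ) 1, ξ ≠ (Real.sqrt 7 - 1) / 3 →
      W ξ < W ((Real.sqrt 7 - 1) / 3)) ∧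
    (Real.sqrt 7 - 1) / 3 + (4 - Real.sqrt 7) / 3 = 1 := by
  have hcurve : ∀ ξ ∈ Set.Ioo (0 : ℝ) 1, W ξ = -6 / (ξ * (1 - ξ) * (2 + ξ)) := by
    intro ξ hξ
    have h0 : ξ ≠ 0 := hξ.1.ne'
    have h1 : 1 - ξ ≠ 0 := (sub_pos.2 hξ.2).ne'
    have h2 : 2 + ξ ≠ 0 := by linarith [hξ.1]
    rw [hW, show 2 - 2 * ξ + 2 * ξ + ξ = 2 + ξ by ring,
      show 2 - 2 * ξ = 2 * (1 - ξ) by ring]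
    field_simp
    ring
  have hmem := sqrt_seven_critical_mem_Ioo
  have hcrit := sqrt_seven_critical_eq
  set c := (Real.sqrt 7 - 1) / 3 with hc
  refine ⟨hcurve, fun ξ hξ => ?_, fun ξ hξ hne => ?_, by rw [hc]; ring⟩
  · have heq : W =ᶠ[nhds ξ] fun y => -6 / (y * (1 - y) * (2 + y)) :=
      Filter.eventually_of_mem (isOpen_Ioo.mem_nhds hξ) hcurve
    rw [heq.deriv_eq, (hasDerivAt_dissociation_curve hξ).deriv,
      div_eq_zero_iff, or_iff_left (pow_ne_zero 2 (dissociation_cubic_pos hξ).ne')]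
    constructor
    · intro h
      have hprod : (ξ - c) * (3 * (ξ + c) + 2) = 0 := by linear_combination hcrit - h / 6
      have hpos : 3 * (ξ + c) + 2 ≠ 0 := by linarith [hξ.1, hmem.1]
      exact sub_eq_zero.1 ((mul_eq_zero.1 hprod).resolve_right hpos)
    · rintro rfl
      rw [hcrit, mul_zero]
  · rw [hcurve ξ hξ, hcurve c hmem, neg_div, neg_div, neg_lt_neg_iff]
    refine div_lt_div_of_pos_left (by norm_num) (dissociation_cubic_pos hξ) ?_
    have hgap : 0 < (ξ - c) ^ 2 * (1 + 2 * c + ξ) :=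
      mul_pos (sq_pos_of_ne_zero (sub_ne_zero.2 hne)) (by linarith [hξ.1, hmem.1])
    linear_combination hgap + (ξ - c) * hcrit
end
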